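/- Let n and k be positive integers with k < n, and let M be a positive integer dividing J_{3^k}. Then M · 3^n divides J_{M · 3^n}. -/

import Mathlib

/-- The Jacobsthal sequence: J 0 = 0, J 1 = 1, J (k+2) = J (k+1) + 2 * J k. -/
def J : ℕ → ℕ
  | 0 => 0
  | 1 => 1
  | (k + 2) => J (k + 1) + 2 * J k

/-- Integer form of Binet's formula for the Jacobsthal numbers. -/
lemma three_mul_J (m : ℕ) : (3 * J m : ℤ) = 2 ^ m - (-1) ^ m := by
  induction m using Nat.twoStepInduction with
  | zero => simp [J]
  | one => simp [J]
  | more m ih₁ ih₂ =>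
    simp only [J]
    push_cast
    rw [pow_succ] at ih₂
    rw [pow_succ (-1) m] at ih₂
    linear_combination ih₂ + 2 * ih₁

lemma three_mul_J_of_odd {m : ℕ} (hm : Odd m) : (3 * J m : ℤ) = -((-2) ^ m - 1) := by
  rw [three_mul_J, hm.neg_one_pow, hm.neg_pow]
  ring

lemma odd_J {m : ℕ} (hm : 0 < m) : Odd (J m) := by
  induction m using Nat.twoStepInduction with
  | zero => omega
  | one => simp [J]
  | more m _ ih =>
    simp only [J]
    exact (ih m.succ_pos).add_even (even_two_mul _)

/-- If both `d` and `m` divide `a - 1`, then `d * m` divides `a ^ m - 1`. -/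
lemma Int.mul_dvd_pow_sub_one {a d : ℤ} {m : ℕ} (hd : d ∣ a - 1) (hm : (m : ℤ) ∣ a - 1) :
    d * m ∣ a ^ m - 1 := by
  rw [← mul_geom_sum]
  refine mul_dvd_mul hd ?_
  have h : (m : ℤ) ∣ ∑ i ∈ Finset.range m, (a ^ i - 1) :=
    Finset.dvd_sum fun i _ => hm.trans (sub_one_dvd_pow_sub_one a i)
  simpa [Finset.sum_sub_distrib] using h

lemma three_pow_dvd_neg_two_pow_sub_one (n : ℕ) :
    (3 : ℤ) ^ (n + 1) ∣ (-2) ^ 3 ^ n - 1 := by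
  induction n with
  | zero => norm_num
  | succ n ih =>
    rw [pow_succ (3 : ℤ), pow_succ (3 : ℕ), pow_mul]
    exact_mod_cast Int.mul_dvd_pow_sub_one ih ((dvd_pow_self 3 n.succ_ne_zero).trans ih)

theorem jacobsthal_factor_three_pow (n k M : ℕ) (hk : 0 < k) (hn : 0 < n)
    (hkn : k < n) (hM : 0 < M) (hdvd : M ∣ J (3 ^ k)) :
    M * 3 ^ n ∣ J (M * 3 ^ n) := by
  have odd_three_pow (i : ℕ) : Odd (3 ^ i) := Odd.pow (by decide)
  have hM_odd : Odd M := (odd_J (by positivity)).of_dvd_nat hdvd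
  have hM_dvd : (M : ℤ) ∣ (-2) ^ 3 ^ n - 1 := by
    have h : (M : ℤ) ∣ (-2) ^ 3 ^ k - 1 := by
      rw [← dvd_neg, ← three_mul_J_of_odd (odd_three_pow k)]
      exact (Int.natCast_dvd_natCast.mpr hdvd).mul_left 3
    obtain ⟨c, hc⟩ := pow_dvd_pow 3 hkn.le
    rw [hc, pow_mul]
    exact h.trans (sub_one_dvd_pow_sub_one _ c)
  have key := Int.mul_dvd_pow_sub_one (three_pow_dvd_neg_two_pow_sub_one n) hM_dvd
  rw [← pow_mul, mul_comm (3 ^ n) M, ← dvd_neg,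
    ← three_mul_J_of_odd (hM_odd.mul (odd_three_pow n))] at key
  have h : 3 * (M * 3 ^ n) ∣ 3 * J (M * 3 ^ n) := by
    rw [← Int.natCast_dvd_natCast]
    push_cast
    rwa [show (3 * (M * 3 ^ n) : ℤ) = 3 ^ (n + 1) * M by ring]
  exact Nat.dvd_of_mul_dvd_mul_left (by norm_num) h
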